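/- Let m ≥ n ≥ 1 and let f : ℝᵐ → ℝⁿ be a smooth (infinitely differentiable) map. Then for λₙ-almost every y ∈ ℝⁿ, every point x ∈ f⁻¹({y}) is a regular point of f (the derivative Df(x) : ℝᵐ → ℝⁿ is surjective); equivalently, the set of critical values of f has n-dimensional Lebesgue measure zero. -/

import Mathlib

open MeasureTheory

namespace SardAux

open scoped ContDiff Topology

/-- Images are null if they are locally null. -/
lemma null_of_local {E F : Type} [TopologicalSpace E] [SecondCountableTopology E]
    [MeasurableSpace F] (μ : Measure F) (f : E → F) (S : Set E)
    (h : ∀ x ∈ S, ∃ W ∈ 𝓝 x, μ (f '' (S ∩ W)) = 0) : μ (f '' S) = 0 := by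
  choose! W hW hnull using h
  obtain ⟨t, htS, htc, hcov⟩ := TopologicalSpace.countable_cover_nhdsWithin
    (f := W) (s := S) (fun x hx => mem_nhdsWithin_of_mem_nhds (hW x hx))
  refine measure_mono_null (t := ⋃ x ∈ t, f '' (S ∩ W x)) ?_ ?_
  · rintro _ ⟨x, hx, rfl⟩
    obtain ⟨i, hi, hxi⟩ := Set.mem_iUnion₂.1 (hcov hx)
    exact Set.mem_iUnion₂.2 ⟨i, hi, x, ⟨hx, hxi⟩, rfl⟩
  · exact (measure_biUnion_null_iff htc).2 fun i hi => hnull i (htS hi)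

lemma isOpen_surj {E F : Type} [NormedAddCommGroup E] [NormedSpace ℝ E] [FiniteDimensional ℝ E]
    [NormedAddCommGroup F] [NormedSpace ℝ F] [FiniteDimensional ℝ F] :
    IsOpen {A : E →L[ℝ] F | Function.Surjective A} := by
  rw [isOpen_iff_mem_nhds]
  intro A hA
  obtain ⟨R, hR⟩ := (A : E →ₗ[ℝ] F).exists_rightInverse_of_surjective (LinearMap.range_eq_top.2 hA)
  let R' : F →L[ℝ] E := LinearMap.toContinuousLinearMap R
  have hcont : Continuous (fun B : E →L[ℝ] F => (B.comp R' : F →L[ℝ] F)) := by fun_prop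
  have : {B : E →L[ℝ] F | IsUnit (B.comp R' : F →L[ℝ] F)} ∈ 𝓝 A := by
    refine (Units.isOpen.preimage hcont).mem_nhds ?_
    have : A.comp R' = 1 := by
      ext x
      exact LinearMap.congr_fun hR x
    change IsUnit (A.comp R')
    rw [this]; exact isUnit_one
  filter_upwards [this] with B hB y
  obtain ⟨u, hu⟩ := hB
  refine ⟨R' ((↑u⁻¹ : F →L[ℝ] F) y), ?_⟩
  have h1 : ((u : F →L[ℝ] F) * (↑u⁻¹ : F →L[ℝ] F)) y = y := by rw [Units.mul_inv]; rfl
  rw [hu] at h1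
  exact h1

lemma linsplit {E : Type} [NormedAddCommGroup E] [NormedSpace ℝ E] [FiniteDimensional ℝ E]
    (L : E →L[ℝ] ℝ) (hL : L ≠ 0) :
    ∃ (E' : Submodule ℝ E) (P : E →L[ℝ] E') (A : E ≃L[ℝ] ℝ × E'),
      ∀ z, A z = (L z, P z) := by
  obtain ⟨w, hw⟩ : ∃ w, L w ≠ 0 := by
    by_contra! h; exact hL (by ext z; simpa using h z)
  obtain ⟨v, hv⟩ : ∃ v, L v = 1 := ⟨(L w)⁻¹ • w, by simp [hw]⟩
  let P : E →ₗ[ℝ] LinearMap.ker (L : E →ₗ[ℝ] ℝ) :=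
    LinearMap.codRestrict _ (LinearMap.id - (L : E →ₗ[ℝ] ℝ).smulRight v) (fun z => by simp [hv])
  have hP : ∀ z, (P z : E) = z - L z • v := fun z => rfl
  let A : E →ₗ[ℝ] ℝ × LinearMap.ker (L : E →ₗ[ℝ] ℝ) := (L : E →ₗ[ℝ] ℝ).prod P
  let B : ℝ × LinearMap.ker (L : E →ₗ[ℝ] ℝ) →ₗ[ℝ] E :=
    (LinearMap.toSpanSingleton ℝ E v).coprod (Submodule.subtype _)
  let A' : E ≃ₗ[ℝ] ℝ × LinearMap.ker (L : E →ₗ[ℝ] ℝ) := LinearEquiv.ofLinearMap A B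
    (by
      apply LinearMap.ext
      rintro ⟨t, k, hk⟩
      have hk' : L k = 0 := hk
      ext <;> simp [A, B, hP, hv, hk'])
    (by
      apply LinearMap.ext
      intro z
      simp [A, B, hP])
  exact ⟨_, LinearMap.toContinuousLinearMap P, A'.toContinuousLinearEquiv, fun z => rfl⟩

/-- Straightening a submersion to `ℝ`. -/
lemma straighten {E : Type} [NormedAddCommGroup E] [NormedSpace ℝ E] [FiniteDimensional ℝ E]
    {m : ℕ} (hE : Module.finrank ℝ E = m + 1) (φ : E → ℝ) (U : Set E) (hU : IsOpen U)
    (hφ : ContDiffOn ℝ ∞ φ U) (x : E) (hx : x ∈ U) (hd : fderiv ℝ φ x ≠ 0) :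
    ∃ (E' : Submodule ℝ E) (V : Set (ℝ × E')) (ψ : ℝ × E' → E),
      Module.finrank ℝ E' = m ∧ IsOpen V ∧ ContDiffOn ℝ ∞ ψ V ∧ Set.MapsTo ψ V U ∧
      ψ '' V ∈ 𝓝 x ∧ ∀ v ∈ V, φ (ψ v) = v.1 := by
  obtain ⟨E', P, A, hA⟩ := linsplit _ hd
  let h : E → ℝ × E' := fun z => (φ z, P z)
  have hh : ContDiffOn ℝ ∞ h U := hφ.prodMk P.contDiff.contDiffOn
  have hφx : HasFDerivAt φ (fderiv ℝ φ x) x :=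
    ((hφ.contDiffAt (hU.mem_nhds hx)).differentiableAt (by simp)).hasFDerivAt
  have hhx : HasFDerivAt h (A : E →L[ℝ] ℝ × E') x := by
    have : (A : E →L[ℝ] ℝ × E') = (fderiv ℝ φ x).prod P := by
      apply ContinuousLinearMap.ext; intro z; exact hA z
    rw [this]
    exact hφx.prodMk P.hasFDerivAt
  let e := (hh.contDiffAt (hU.mem_nhds hx)).toOpenPartialHomeomorph h hhx (by simp)
  have he : (e : E → ℝ × E') = h := rfl
  have hxe : x ∈ e.source :=
    (hh.contDiffAt (hU.mem_nhds hx)).mem_toOpenPartialHomeomorph_source hhx (by simp)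
  let U' := U ∩ fderiv ℝ h ⁻¹' (Set.range ((↑) : (E ≃L[ℝ] ℝ × E') → (E →L[ℝ] ℝ × E')))
  have hU' : IsOpen U' := by
    refine ContinuousOn.isOpen_inter_preimage (hh.continuousOn_fderiv_of_isOpen hU (by simp)) hU ?_
    exact ContinuousLinearEquiv.isOpen
  have hxU' : x ∈ U' := ⟨hx, A, hhx.fderiv.symm⟩
  refine ⟨E', e.target ∩ e.symm ⁻¹' U', e.symm, ?_, e.isOpen_inter_preimage_symm hU', ?_, ?_, ?_, ?_⟩
  · have := A.toLinearEquiv.finrank_eq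
    rw [hE, Module.finrank_prod, Module.finrank_self] at this
    omega
  · rintro v ⟨hv, hvU, B, hB⟩
    refine (e.contDiffAt_symm hv (f₀' := B) ?_ ?_).contDiffWithinAt
    · rw [hB, he]
      exact ((hh.contDiffAt (hU.mem_nhds hvU)).differentiableAt (by simp)).hasFDerivAt
    · exact hh.contDiffAt (hU.mem_nhds hvU)
  · rintro v ⟨hv, hvU, -⟩
    exact hvU
  · refine Filter.mem_of_superset (Filter.inter_mem (e.open_source.mem_nhds hxe) (hU'.mem_nhds hxU')) ?_
    rintro z ⟨hz, hzU⟩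
    refine ⟨e z, ⟨e.map_source hz, ?_⟩, e.left_inv hz⟩
    change e.symm (e z) ∈ U'
    rwa [e.left_inv hz]
  · rintro v ⟨hv, -⟩
    have : h (e.symm v) = v := e.right_inv hv
    exact congrArg Prod.fst this

/-- Taylor-type bound. -/
lemma taylor {E : Type} [NormedAddCommGroup E] [NormedSpace ℝ E] (B : Set E) (hB : IsOpen B)
    (hconv : Convex ℝ B) (x : E) (hx : x ∈ B) (M : ℝ) (k : ℕ) :
    ∀ (G : Type) [NormedAddCommGroup G] [NormedSpace ℝ G] (g : E → G),
      ContDiffOn ℝ ∞ g B → (∀ j < k, iteratedFDeriv ℝ (j + 1) g x = 0) →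
      (∀ y ∈ B, ‖iteratedFDeriv ℝ (k + 1) g y‖ ≤ M) →
      ∀ y ∈ B, ‖g y - g x‖ ≤ M * ‖y - x‖ ^ (k + 1) := by
  induction k with
  | zero =>
    intro G _ _ g hg _ hM y hy
    rw [zero_add, pow_one]
    refine hconv.norm_image_sub_le_of_norm_fderiv_le (𝕜 := ℝ) (fun z hz =>
      (hg.contDiffAt (hB.mem_nhds hz)).differentiableAt (by simp)) (fun z hz => ?_) hx hy
    rw [← norm_iteratedFDeriv_one]
    exact hM z hz
  | succ k ih =>
    intro G _ _ g hg hz hM y hy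
    have hM0 : 0 ≤ M := (norm_nonneg _).trans (hM x hx)
    have key := ih (E →L[ℝ] G) (fderiv ℝ g) (hg.fderiv_of_isOpen hB (by simp))
      (fun j hj => by
        rw [← norm_eq_zero, norm_iteratedFDeriv_fderiv, hz (j + 1) (by omega), norm_zero])
      (fun z hz => by rw [norm_iteratedFDeriv_fderiv]; exact hM z hz)
    have h0 : fderiv ℝ g x = 0 := by
      rw [← norm_eq_zero, ← norm_iteratedFDeriv_one, hz 0 (by omega), norm_zero]
    simp only [h0, sub_zero] at key
    have hc : Convex ℝ (B ∩ Metric.closedBall x ‖y - x‖) := hconv.inter (convex_closedBall _ _)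
    have := hc.norm_image_sub_le_of_norm_fderiv_le (𝕜 := ℝ) (f := g)
      (C := M * ‖y - x‖ ^ (k + 1)) (fun z hz =>
      (hg.contDiffAt (hB.mem_nhds hz.1)).differentiableAt (by simp)) (fun z hz => by
        refine (key z hz.1).trans ?_
        have : ‖z - x‖ ≤ ‖y - x‖ := by simpa [dist_eq_norm] using hz.2
        gcongr) (x := x) (y := y) ⟨hx, by simp⟩ ⟨hy, by simp [dist_eq_norm]⟩
    rw [pow_succ, ← mul_assoc]
    exact this

/-- The points where all derivatives of order `1..k` vanish. -/
def flat {E F : Type} [NormedAddCommGroup E] [NormedSpace ℝ E]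
    [NormedAddCommGroup F] [NormedSpace ℝ F] (f : E → F) (U : Set E) (k : ℕ) : Set E :=
  {x | x ∈ U ∧ ∀ j < k, iteratedFDeriv ℝ (j + 1) f x = 0}

lemma flat_null {E F : Type} [NormedAddCommGroup E] [NormedSpace ℝ E] [FiniteDimensional ℝ E]
    [NormedAddCommGroup F] [NormedSpace ℝ F] [FiniteDimensional ℝ F] [Nontrivial F]
    [MeasurableSpace F] [BorelSpace F] (μ : Measure F) [μ.IsAddHaarMeasure]
    (f : E → F) (U : Set E) (hU : IsOpen U) (hf : ContDiffOn ℝ ∞ f U) :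
    μ (f '' flat f U (Module.finrank ℝ E)) = 0 := by
  set m := Module.finrank ℝ E
  have hdim : dimH (f '' flat f U m) ≤ dimH (flat f U m) / ((m + 1 : ℕ) : NNReal) := by
    refine dimH_image_le_of_locally_holder_on (by positivity) ?_
    rintro x ⟨hx, hxz⟩
    have hc : ContinuousAt (iteratedFDeriv ℝ (m + 1) f) x :=
      ((hf.contDiffAt (hU.mem_nhds hx)).iteratedFDeriv_right (m := 0) (i := m + 1)
        (by simp; exact_mod_cast le_top)).continuousAt
    have hev : ∀ᶠ y in 𝓝 x, y ∈ U ∧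
        ‖iteratedFDeriv ℝ (m + 1) f y‖ < ‖iteratedFDeriv ℝ (m + 1) f x‖ + 1 :=
      (hU.eventually_mem hx).and (hc.norm.eventually_lt continuousAt_const (by simp))
    obtain ⟨r, hr, hball⟩ := Metric.eventually_nhds_iff_ball.1 hev
    set M := ‖iteratedFDeriv ℝ (m + 1) f x‖ + 1
    have hM : 0 ≤ M := by positivity
    refine ⟨M.toNNReal, flat f U m ∩ Metric.ball x r,
      inter_mem_nhdsWithin _ (Metric.ball_mem_nhds x hr), ?_⟩
    rintro a ⟨ha, har⟩ b ⟨hb, hbr⟩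
    have := taylor (Metric.ball x r) Metric.isOpen_ball (convex_ball _ _) b hbr M m F f
      (hf.mono fun y hy => (hball y hy).1) hb.2 (fun y hy => (hball y hy).2.le) a har
    rw [edist_eq_enorm_sub, edist_eq_enorm_sub, NNReal.coe_natCast, ENNReal.rpow_natCast,
      ← enorm_norm (a - b), ← enorm_pow, ← enorm_norm (f a - f b)]
    have e1 : (M.toNNReal : ENNReal) = ‖M‖ₑ := by
      rw [Real.enorm_eq_ofReal hM]; rfl
    rw [e1, ← enorm_mul, Real.enorm_eq_ofReal (by positivity), Real.enorm_eq_ofReal (by positivity)]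
    exact ENNReal.ofReal_le_ofReal this
  have h1 : dimH (flat f U m) ≤ m := by
    refine (dimH_mono (Set.subset_univ _)).trans ?_
    rw [Real.dimH_univ_eq_finrank]
  have hlt : dimH (f '' flat f U m) < ((Module.finrank ℝ F : NNReal) : ENNReal) := by
    have h2 : dimH (f '' flat f U m) < 1 := by
      refine (hdim.trans (ENNReal.div_le_div_right h1 _)).trans_lt ?_
      rw [ENNReal.div_lt_iff (by simp) (by simp)]
      simp only [one_mul]
      exact_mod_cast Nat.lt_succ_self m
    refine h2.trans_le ?_
    have : 1 ≤ Module.finrank ℝ F := Module.finrank_pos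
    exact_mod_cast this
  have h0 := hausdorffMeasure_of_dimH_lt hlt
  rw [NNReal.coe_natCast] at h0
  exact Measure.absolutelyContinuous_isAddHaarMeasure μ (μH[Module.finrank ℝ F]) h0


/-- Sard's theorem for source spaces of dimension `m`. -/
def SardDim (m : ℕ) : Prop :=
  ∀ (E F : Type) [NormedAddCommGroup E] [NormedSpace ℝ E] [FiniteDimensional ℝ E]
    [NormedAddCommGroup F] [NormedSpace ℝ F] [FiniteDimensional ℝ F]
    [MeasurableSpace F] [BorelSpace F] (μ : Measure F) [μ.IsAddHaarMeasure]
    (f : E → F) (U : Set E), Module.finrank ℝ E = m → IsOpen U → ContDiffOn ℝ ∞ f U →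
    μ (f '' {x | x ∈ U ∧ ¬ Function.Surjective (fderiv ℝ f x)}) = 0

/-- Fubini step: maps of the form `(t, z) ↦ (t, g₂ (t, z))`. -/
lemma fubini_step {m : ℕ} (ih : SardDim m) {E F : Type}
    [NormedAddCommGroup E] [NormedSpace ℝ E] [FiniteDimensional ℝ E]
    [NormedAddCommGroup F] [NormedSpace ℝ F] [FiniteDimensional ℝ F]
    [MeasurableSpace F] [BorelSpace F] (hE : Module.finrank ℝ E = m)
    (μ : Measure (ℝ × F)) [μ.IsAddHaarMeasure]
    (g : ℝ × E → ℝ × F) (V : Set (ℝ × E)) (hV : IsOpen V) (hg : ContDiffOn ℝ ∞ g V)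
    (hfst : ∀ v ∈ V, (g v).1 = v.1) :
    μ (g '' {v | v ∈ V ∧ ¬ Function.Surjective (fderiv ℝ g v)}) = 0 := by
  have : BorelSpace (ℝ × F) := inferInstance
  let ν : Measure F := Measure.addHaar
  refine Measure.absolutelyContinuous_isAddHaarMeasure μ ((volume : Measure ℝ).prod ν) ?_
  refine null_of_local _ _ _ ?_
  rintro v₀ ⟨hv₀, -⟩
  obtain ⟨r, hr, hrV⟩ := Metric.nhds_basis_closedBall.mem_iff.1 (hV.mem_nhds hv₀)
  refine ⟨Metric.closedBall v₀ r, Metric.closedBall_mem_nhds _ hr, ?_⟩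
  set K := {v | v ∈ V ∧ ¬ Function.Surjective (fderiv ℝ g v)} ∩ Metric.closedBall v₀ r with hKdef
  have hKV : K ⊆ V := fun v hv => hv.1.1
  have hK : IsCompact K := by
    have hc : ContinuousOn (fderiv ℝ g) (Metric.closedBall v₀ r) :=
      (hg.continuousOn_fderiv_of_isOpen hV (by simp)).mono hrV
    have hcl := hc.preimage_isClosed_of_isClosed Metric.isClosed_closedBall
      (isOpen_surj (E := ℝ × E) (F := ℝ × F)).isClosed_compl
    have : K = Metric.closedBall v₀ r ∩
        fderiv ℝ g ⁻¹' {A : ℝ × E →L[ℝ] ℝ × F | Function.Surjective A}ᶜ := by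
      ext v
      constructor
      · rintro ⟨⟨_, h⟩, h'⟩; exact ⟨h', h⟩
      · rintro ⟨h', h⟩; exact ⟨⟨hrV h', h⟩, h'⟩
    rw [this]
    exact (isCompact_closedBall v₀ r).of_isClosed_subset hcl Set.inter_subset_left
  have hmeas : MeasurableSet (g '' K) :=
    (hK.image_of_continuousOn (hg.continuousOn.mono hKV)).isClosed.measurableSet
  rw [Measure.measure_prod_null hmeas]
  refine Filter.Eventually.of_forall fun t => ?_
  let i : E → ℝ × E := fun z => (t, z)
  have hi : ContDiff ℝ ∞ i := contDiff_const.prodMk contDiff_id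
  have hnull := ih E F ν (fun z => (g (i z)).2) (i ⁻¹' V) hE (hV.preimage hi.continuous)
    (contDiff_snd.comp_contDiffOn (hg.comp hi.contDiffOn (fun z hz => hz)))
  refine measure_mono_null ?_ hnull
  rintro y ⟨⟨s, z⟩, hv, hy⟩
  have hvV := hKV hv
  have hs : s = t := by
    have := hfst _ hvV
    rw [hy] at this
    exact this.symm
  subst hs
  refine ⟨z, ⟨hvV, fun hsurj => hv.1.2 ?_⟩, by simp only [i]; rw [hy]⟩
  have hgd : HasFDerivAt g (fderiv ℝ g (s, z)) (s, z) :=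
    ((hg.contDiffAt (hV.mem_nhds hvV)).differentiableAt (by simp)).hasFDerivAt
  have hid : HasFDerivAt i (ContinuousLinearMap.inr ℝ ℝ E) z := hasFDerivAt_prodMk_right s z
  have h2 : HasFDerivAt (fun z => (g (i z)).2)
      ((ContinuousLinearMap.snd ℝ ℝ F).comp
        ((fderiv ℝ g (s, z)).comp (ContinuousLinearMap.inr ℝ ℝ E))) z :=
    hasFDerivAt_snd.comp z (HasFDerivAt.comp z (g := g) hgd hid)
  rw [h2.fderiv] at hsurj
  have h1 : (ContinuousLinearMap.fst ℝ ℝ F).comp (fderiv ℝ g (s, z)) =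
      ContinuousLinearMap.fst ℝ ℝ E := by
    have ha : HasFDerivAt (fun v => (g v).1)
      ((ContinuousLinearMap.fst ℝ ℝ F).comp (fderiv ℝ g (s, z))) (s, z) :=
      hasFDerivAt_fst.comp _ hgd
    have hb : HasFDerivAt (fun v => (g v).1) (ContinuousLinearMap.fst ℝ ℝ E) (s, z) :=
      hasFDerivAt_fst.congr_of_eventuallyEq
        (Filter.eventuallyEq_of_mem (hV.mem_nhds hvV) hfst)
    exact ha.unique hb
  have h1' : ∀ w, (fderiv ℝ g (s, z) w).1 = w.1 := fun w => DFunLike.congr_fun h1 w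
  rintro ⟨a, b⟩
  obtain ⟨w, hw⟩ := hsurj (b - (fderiv ℝ g (s, z) (a, 0)).2)
  have hw2 : (fderiv ℝ g (s, z) (0, w)).2 = b - (fderiv ℝ g (s, z) (a, 0)).2 := hw
  refine ⟨(a, 0) + (0, w), ?_⟩
  rw [map_add]
  ext
  · simp [h1']
  · simp [hw2]

/-- Points where the derivative is nonzero. -/
lemma nonzero_step {m : ℕ} (ih : SardDim m) {E F : Type}
    [NormedAddCommGroup E] [NormedSpace ℝ E] [FiniteDimensional ℝ E]
    [NormedAddCommGroup F] [NormedSpace ℝ F] [FiniteDimensional ℝ F]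
    [MeasurableSpace F] [BorelSpace F] (μ : Measure F) [μ.IsAddHaarMeasure]
    (f : E → F) (U : Set E) (hE : Module.finrank ℝ E = m + 1) (hU : IsOpen U)
    (hf : ContDiffOn ℝ ∞ f U) :
    μ (f '' {x | (x ∈ U ∧ ¬ Function.Surjective (fderiv ℝ f x)) ∧ fderiv ℝ f x ≠ 0}) = 0 := by
  refine null_of_local _ _ _ ?_
  rintro x ⟨⟨hx, -⟩, hd⟩
  obtain ⟨w, hw⟩ : ∃ w, fderiv ℝ f x w ≠ 0 := by
    by_contra! h; exact hd (by ext z; simpa using h z)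
  obtain ⟨ℓ, hℓ⟩ := SeparatingDual.exists_ne_zero (R := ℝ) hw
  obtain ⟨F', P, A, hA⟩ := linsplit ℓ (by rintro rfl; simp at hℓ)
  have hfx : HasFDerivAt f (fderiv ℝ f x) x :=
    ((hf.contDiffAt (hU.mem_nhds hx)).differentiableAt (by simp)).hasFDerivAt
  obtain ⟨E', V, ψ, hE', hV, hψ, hmaps, hnhds, hst⟩ := straighten hE (fun z => ℓ (f z)) U hU
    (ℓ.contDiff.comp_contDiffOn hf) x hx (by
      have : HasFDerivAt (fun z => ℓ (f z)) (ℓ.comp (fderiv ℝ f x)) x :=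
        ℓ.hasFDerivAt.comp x hfx
      rw [this.fderiv]
      intro h0
      exact hℓ (DFunLike.congr_fun h0 w))
  refine ⟨_, hnhds, ?_⟩
  let g : ℝ × E' → ℝ × F' := fun v => A (f (ψ v))
  have hg : ContDiffOn ℝ ∞ g V := A.contDiff.comp_contDiffOn (hf.comp hψ hmaps)
  have hm : Measurable A := A.continuous.measurable
  have := fubini_step ih hE' (μ.map A) g V hV hg (fun v hv => by
    simp only [g, hA]; exact hst v hv)
  have hpre := Measure.preimage_null_of_map_null hm.aemeasurable this
  refine measure_mono_null ?_ hpre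
  rintro _ ⟨_, ⟨⟨⟨_, hns⟩, _⟩, v, hv, rfl⟩, rfl⟩
  refine ⟨v, ⟨hv, fun hs => hns ?_⟩, rfl⟩
  have hfd : HasFDerivAt f (fderiv ℝ f (ψ v)) (ψ v) :=
    ((hf.contDiffAt (hU.mem_nhds (hmaps hv))).differentiableAt (by simp)).hasFDerivAt
  have hψd : HasFDerivAt ψ (fderiv ℝ ψ v) v :=
    ((hψ.contDiffAt (hV.mem_nhds hv)).differentiableAt (by simp)).hasFDerivAt
  have hgd : HasFDerivAt g ((A : F →L[ℝ] ℝ × F').comp ((fderiv ℝ f (ψ v)).comp (fderiv ℝ ψ v))) v :=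
    A.hasFDerivAt.comp v (hfd.comp v hψd)
  rw [hgd.fderiv] at hs
  intro y
  obtain ⟨u, hu⟩ := hs (A y)
  exact ⟨fderiv ℝ ψ v u, A.injective hu⟩

/-- Points where the derivatives vanish exactly up to order `k`. -/
lemma flat_step {m : ℕ} (ih : SardDim m) {E F : Type}
    [NormedAddCommGroup E] [NormedSpace ℝ E] [FiniteDimensional ℝ E]
    [NormedAddCommGroup F] [NormedSpace ℝ F] [FiniteDimensional ℝ F] [Nontrivial F]
    [MeasurableSpace F] [BorelSpace F] (μ : Measure F) [μ.IsAddHaarMeasure]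
    (f : E → F) (U : Set E) (hE : Module.finrank ℝ E = m + 1) (hU : IsOpen U)
    (hf : ContDiffOn ℝ ∞ f U) (k : ℕ) :
    μ (f '' (flat f U (k + 1) \ flat f U (k + 2))) = 0 := by
  refine null_of_local _ _ _ ?_
  rintro x ⟨⟨hx, hz⟩, hne⟩
  have hne' : iteratedFDeriv ℝ (k + 2) f x ≠ 0 := by
    intro h0
    refine hne ⟨hx, fun j hj => ?_⟩
    rcases Nat.lt_succ_iff_lt_or_eq.1 hj with h | rfl
    · exact hz j h
    · exact h0
  have hd : fderiv ℝ (iteratedFDeriv ℝ (k + 1) f) x ≠ 0 := by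
    intro h0
    refine hne' (ContinuousMultilinearMap.ext fun v => ?_)
    rw [iteratedFDeriv_succ_apply_left, h0]
    rfl
  obtain ⟨w, hw⟩ : ∃ w, fderiv ℝ (iteratedFDeriv ℝ (k + 1) f) x w ≠ 0 := by
    by_contra! h; exact hd (by apply ContinuousLinearMap.ext; intro z; simpa using h z)
  obtain ⟨ℓ, hℓ⟩ := SeparatingDual.exists_ne_zero (R := ℝ) hw
  have hD : ContDiffOn ℝ ∞ (iteratedFDeriv ℝ (k + 1) f) U := fun y hy =>
    ((hf.contDiffAt (hU.mem_nhds hy)).iteratedFDeriv_right (m := ∞) (i := k + 1)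
      (by exact_mod_cast le_top)).contDiffWithinAt
  obtain ⟨E', V, ψ, hE', hV, hψ, hmaps, hnhds, hst⟩ := straighten hE
    (fun z => ℓ (iteratedFDeriv ℝ (k + 1) f z)) U hU
    (ℓ.contDiff.comp_contDiffOn hD) x hx (by
      have hfx := ((hD.contDiffAt (hU.mem_nhds hx)).differentiableAt (by simp)).hasFDerivAt
      have : HasFDerivAt (fun z => ℓ (iteratedFDeriv ℝ (k + 1) f z))
        (ℓ.comp (fderiv ℝ (iteratedFDeriv ℝ (k + 1) f) x)) x :=
        ℓ.hasFDerivAt.comp x hfx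
      rw [this.fderiv]
      intro h0
      exact hℓ (DFunLike.congr_fun h0 w))
  refine ⟨_, hnhds, ?_⟩
  let i : E' → ℝ × E' := fun z => (0, z)
  have hi : ContDiff ℝ ∞ i := contDiff_const.prodMk contDiff_id
  have hψi : ContDiffOn ℝ ∞ (fun z => ψ (i z)) (i ⁻¹' V) := hψ.comp hi.contDiffOn (fun z hz => hz)
  have hVi : IsOpen (i ⁻¹' V) := hV.preimage hi.continuous
  have hnull := ih E' F μ (fun z => f (ψ (i z))) (i ⁻¹' V) hE' hVi
    (hf.comp hψi (fun z hz => hmaps hz))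
  refine measure_mono_null ?_ hnull
  rintro _ ⟨_, ⟨⟨⟨_, hz'⟩, _⟩, ⟨t, z⟩, hv, rfl⟩, rfl⟩
  have ht : t = 0 := by
    have := hst _ hv
    simp only [hz' k (Nat.lt_succ_self k), map_zero] at this
    exact this.symm
  subst ht
  refine ⟨z, ⟨hv, ?_⟩, rfl⟩
  have h0 : fderiv ℝ f (ψ (0, z)) = 0 := by
    rw [← norm_eq_zero, ← norm_iteratedFDeriv_one, hz' 0 (by omega), norm_zero]
  have hfd : HasFDerivAt f (0 : E →L[ℝ] F) (ψ (0, z)) := by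
    rw [← h0]
    exact ((hf.contDiffAt (hU.mem_nhds (hmaps hv))).differentiableAt (by simp)).hasFDerivAt
  have hψd : HasFDerivAt (fun z => ψ (i z)) (fderiv ℝ (fun z => ψ (i z)) z) z :=
    ((hψi.contDiffAt (hVi.mem_nhds hv)).differentiableAt (by simp)).hasFDerivAt
  have hc : HasFDerivAt (fun z => f (ψ (i z)))
    ((0 : E →L[ℝ] F).comp (fderiv ℝ (fun z => ψ (i z)) z)) z :=
    HasFDerivAt.comp z (g := f) hfd hψd
  rw [hc.fderiv]
  intro hs
  obtain ⟨y, hy⟩ := exists_ne (0 : F)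
  obtain ⟨u, hu⟩ := hs y
  exact hy (by rw [← hu]; simp)

theorem sardDim (m : ℕ) : SardDim m := by
  induction m with
  | zero =>
    intro E F _ _ _ _ _ _ _ _ μ _ f U hE hU hf
    have hsub : Subsingleton E := Module.finrank_zero_iff.1 hE
    rcases subsingleton_or_nontrivial F with hF | hF
    · have : {x | x ∈ U ∧ ¬ Function.Surjective (fderiv ℝ f x)} = ∅ := by
        ext x
        simp only [Set.mem_ofPred_eq, Set.mem_empty_iff_false, iff_false, not_and, not_not]
        exact fun _ y => ⟨0, Subsingleton.elim _ _⟩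
      rw [this]; simp
    exact (Set.Subsingleton.image (Set.subsingleton_of_subsingleton) f).measure_zero μ
  | succ m ih =>
    intro E F _ _ _ _ _ _ _ _ μ _ f U hE hU hf
    rcases subsingleton_or_nontrivial F with hF | hF
    · have : {x | x ∈ U ∧ ¬ Function.Surjective (fderiv ℝ f x)} = ∅ := by
        ext x
        simp only [Set.mem_ofPred_eq, Set.mem_empty_iff_false, iff_false, not_and, not_not]
        exact fun _ y => ⟨0, Subsingleton.elim _ _⟩
      rw [this]; simp
    have hflat : ∀ d k, k + 1 + d = m + 1 → μ (f '' flat f U (k + 1)) = 0 := by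
      intro d
      induction d with
      | zero =>
        intro k hk
        have := flat_null μ f U hU hf
        rwa [hE, ← hk] at this
      | succ d ihd =>
        intro k hk
        refine measure_mono_null (t := f '' (flat f U (k + 1) \ flat f U (k + 2)) ∪
          f '' flat f U (k + 2)) ?_
          (measure_union_null (flat_step ih μ f U hE hU hf k) (ihd (k + 1) (by omega)))
        rw [← Set.image_union]
        exact Set.image_mono (fun y hy => by by_cases h : y ∈ flat f U (k + 2) <;> simp [h, hy])
    refine measure_mono_null ?_
      (measure_union_null (nonzero_step ih μ f U hE hU hf) (hflat m 0 (by omega)))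
    rw [← Set.image_union]
    refine Set.image_mono (fun y hy => ?_)
    by_cases h : fderiv ℝ f y = 0
    · right
      refine ⟨hy.1, fun j hj => ?_⟩
      obtain rfl : j = 0 := by omega
      rw [← norm_eq_zero, zero_add, norm_iteratedFDeriv_one, h, norm_zero]
    · exact Or.inl ⟨hy, h⟩

end SardAux

/-- **Sard's theorem / regularity of almost every fiber.** -/
theorem critical_values_volume_zero (m n : ℕ) (hn : 1 ≤ n) (hmn : n ≤ m)
    (f : EuclideanSpace ℝ (Fin m) → EuclideanSpace ℝ (Fin n))
    (hf : ContDiff ℝ (⊤ : ℕ∞) f) :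
    volume (f '' {x | ¬ Function.Surjective (fderiv ℝ f x)}) = 0 ∧
    ∀ᵐ y ∂(volume : Measure (EuclideanSpace ℝ (Fin n))),
      ∀ x ∈ f ⁻¹' {y}, Function.Surjective (fderiv ℝ f x) := by
  have h := SardAux.sardDim m (EuclideanSpace ℝ (Fin m)) (EuclideanSpace ℝ (Fin n)) volume f
    Set.univ (by simp) isOpen_univ hf.contDiffOn
  simp only [Set.mem_univ, true_and] at h
  refine ⟨h, ?_⟩
  rw [ae_iff]
  refine measure_mono_null ?_ h
  intro y hy
  simp only [Set.mem_ofPred_eq, not_forall] at hy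
  obtain ⟨x, hx, hns⟩ := hy
  exact ⟨x, hns, hx⟩
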